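/- (One-step contraction of the natural policy gradient method.) Suppose K ∈ 𝕂 and let K' = K − 2ηL^K with 0 < η ≤ 1/(2·max_i ‖R_i + B_iᵀ E_i(P^K) B_i‖). Then C(K') − C(K*) ≤ (1 − 2μΛ_min(R)η/‖𝐗^{K*}‖_max)·(C(K) − C(K*)). -/

import Mathlib

open Matrix Filter
open scoped Kronecker Topology

namespace MJLS

noncomputable section

attribute [local instance] Classical.propDecidable

/-- Closed-loop matrices `Γ i = A i - B i * K i`. -/
def Gam {d k N : ℕ} (A : Fin N → Matrix (Fin d) (Fin d) ℝ)
    (B : Fin N → Matrix (Fin d) (Fin k) ℝ)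
    (K : Fin N → Matrix (Fin k) (Fin d) ℝ) : Fin N → Matrix (Fin d) (Fin d) ℝ :=
  fun i => A i - B i * K i

/-- The operator `E_i(V) = ∑ j, p i j • V j`. -/
def opE {d N : ℕ} (Pr : Matrix (Fin N) (Fin N) ℝ)
    (V : Fin N → Matrix (Fin d) (Fin d) ℝ) : Fin N → Matrix (Fin d) (Fin d) ℝ :=
  fun i => ∑ j, Pr i j • V j

/-- The matrix `𝒜 = diag(Γᵀ ⊗ Γᵀ) (P ⊗ I)`. -/
def calA {d N : ℕ} (Pr : Matrix (Fin N) (Fin N) ℝ)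
    (Γ : Fin N → Matrix (Fin d) (Fin d) ℝ) :
    Matrix (Fin N × Fin d × Fin d) (Fin N × Fin d × Fin d) ℝ :=
  (Matrix.reindex (Equiv.prodComm (Fin d × Fin d) (Fin N))
      (Equiv.prodComm (Fin d × Fin d) (Fin N))
      (Matrix.blockDiagonal fun i => (Γ i)ᵀ ⊗ₖ (Γ i)ᵀ)) *
    (Pr ⊗ₖ (1 : Matrix (Fin d × Fin d) (Fin d × Fin d) ℝ))

/-- `K` is mean-square stabilizing: the spectral radius of `𝒜` is less than `1`. -/
def MSS {d k N : ℕ} (Pr : Matrix (Fin N) (Fin N) ℝ)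
    (A : Fin N → Matrix (Fin d) (Fin d) ℝ) (B : Fin N → Matrix (Fin d) (Fin k) ℝ)
    (K : Fin N → Matrix (Fin k) (Fin d) ℝ) : Prop :=
  spectralRadius ℂ ((calA Pr (Gam A B K)).map (algebraMap ℝ ℂ)) < 1

/-- `P` solves the coupled Lyapunov equations for the policy `K`. -/
def IsLyap {d k N : ℕ} (Pr : Matrix (Fin N) (Fin N) ℝ)
    (A : Fin N → Matrix (Fin d) (Fin d) ℝ) (B : Fin N → Matrix (Fin d) (Fin k) ℝ)
    (Q : Fin N → Matrix (Fin d) (Fin d) ℝ) (R : Fin N → Matrix (Fin k) (Fin k) ℝ)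
    (K : Fin N → Matrix (Fin k) (Fin d) ℝ)
    (P : Fin N → Matrix (Fin d) (Fin d) ℝ) : Prop :=
  ∀ i, P i = Q i + (K i)ᵀ * R i * K i + (Gam A B K i)ᵀ * opE Pr P i * Gam A B K i

/-- `P^K`, the (for mean-square stabilizing `K`, unique) solution of the coupled
Lyapunov equations. -/
def PK {d k N : ℕ} (Pr : Matrix (Fin N) (Fin N) ℝ)
    (A : Fin N → Matrix (Fin d) (Fin d) ℝ) (B : Fin N → Matrix (Fin d) (Fin k) ℝ)
    (Q : Fin N → Matrix (Fin d) (Fin d) ℝ) (R : Fin N → Matrix (Fin k) (Fin k) ℝ)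
    (K : Fin N → Matrix (Fin k) (Fin d) ℝ) : Fin N → Matrix (Fin d) (Fin d) ℝ :=
  if h : ∃ P, IsLyap Pr A B Q R K P then h.choose else 0

/-- The LQR cost `C(K) = ∑ i, π i * tr(P^K_i Sg)`. -/
def cost {d k N : ℕ} (Pr : Matrix (Fin N) (Fin N) ℝ)
    (A : Fin N → Matrix (Fin d) (Fin d) ℝ) (B : Fin N → Matrix (Fin d) (Fin k) ℝ)
    (Q : Fin N → Matrix (Fin d) (Fin d) ℝ) (R : Fin N → Matrix (Fin k) (Fin k) ℝ)
    (piv : Fin N → ℝ) (Sg : Matrix (Fin d) (Fin d) ℝ)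
    (K : Fin N → Matrix (Fin k) (Fin d) ℝ) : ℝ :=
  ∑ i, piv i * (PK Pr A B Q R K i * Sg).trace

/-- The operator `T_j(V) = ∑ i, p i j • (Γ i * V i * Γ iᵀ)`. -/
def opT {d N : ℕ} (Pr : Matrix (Fin N) (Fin N) ℝ)
    (Γ : Fin N → Matrix (Fin d) (Fin d) ℝ)
    (V : Fin N → Matrix (Fin d) (Fin d) ℝ) : Fin N → Matrix (Fin d) (Fin d) ℝ :=
  fun j => ∑ i, Pr i j • (Γ i * V i * (Γ i)ᵀ)

/-- `𝐗^K = ∑_{t=0}^∞ T^t(X(0))` with `X_i(0) = π i • Sg`. -/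
def XK {d N : ℕ} (Pr : Matrix (Fin N) (Fin N) ℝ) (piv : Fin N → ℝ)
    (Sg : Matrix (Fin d) (Fin d) ℝ) (Γ : Fin N → Matrix (Fin d) (Fin d) ℝ) :
    Fin N → Matrix (Fin d) (Fin d) ℝ :=
  ∑' t : ℕ, (opT Pr Γ)^[t] (fun i => piv i • Sg)

/-- `L^K_i = (R i + B iᵀ E_i(P^K) B i) K i - B iᵀ E_i(P^K) A i`. -/
def LK {d k N : ℕ} (Pr : Matrix (Fin N) (Fin N) ℝ)
    (A : Fin N → Matrix (Fin d) (Fin d) ℝ) (B : Fin N → Matrix (Fin d) (Fin k) ℝ)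
    (Q : Fin N → Matrix (Fin d) (Fin d) ℝ) (R : Fin N → Matrix (Fin k) (Fin k) ℝ)
    (K : Fin N → Matrix (Fin k) (Fin d) ℝ) : Fin N → Matrix (Fin k) (Fin d) ℝ :=
  fun i => (R i + (B i)ᵀ * opE Pr (PK Pr A B Q R K) i * B i) * K i
    - (B i)ᵀ * opE Pr (PK Pr A B Q R K) i * A i

/-- The operator `L_i(V) = Γ iᵀ E_i(V) Γ i`. -/
def opL {d N : ℕ} (Pr : Matrix (Fin N) (Fin N) ℝ)
    (Γ : Fin N → Matrix (Fin d) (Fin d) ℝ)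
    (V : Fin N → Matrix (Fin d) (Fin d) ℝ) : Fin N → Matrix (Fin d) (Fin d) ℝ :=
  fun i => (Γ i)ᵀ * opE Pr V i * Γ i

/-- `(P^K)'[E] = ∑_{t=0}^∞ L^t(Eᵀ L^K + (L^K)ᵀ E)`. -/
def PKd {d k N : ℕ} (Pr : Matrix (Fin N) (Fin N) ℝ)
    (Γ : Fin N → Matrix (Fin d) (Fin d) ℝ)
    (Lk E : Fin N → Matrix (Fin k) (Fin d) ℝ) : Fin N → Matrix (Fin d) (Fin d) ℝ :=
  ∑' t : ℕ, (opL Pr Γ)^[t] (fun i => (E i)ᵀ * Lk i + (Lk i)ᵀ * E i)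

/-- `‖V‖₂² = ∑ i, tr(V iᵀ V i)`. -/
def norm2sq {a b N : ℕ} (V : Fin N → Matrix (Fin a) (Fin b) ℝ) : ℝ :=
  ∑ i, ((V i)ᵀ * V i).trace

/-- The inner product `⟨V, S⟩ = ∑ i, tr(V iᵀ S i)`. -/
def ip {a b N : ℕ} (V S : Fin N → Matrix (Fin a) (Fin b) ℝ) : ℝ :=
  ∑ i, ((V i)ᵀ * S i).trace

/-- The spectral norm (maximal singular value) of a matrix. -/
def specNorm {a b : ℕ} (M : Matrix (Fin a) (Fin b) ℝ) : ℝ :=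
  ⨆ x : {x : EuclideanSpace ℝ (Fin b) // ‖x‖ ≤ 1}, ‖Matrix.toEuclideanLin M x.1‖

/-- The minimal singular value of a square matrix. -/
def sigmaMin {a : ℕ} (M : Matrix (Fin a) (Fin a) ℝ) : ℝ :=
  ⨅ x : {x : EuclideanSpace ℝ (Fin a) // ‖x‖ = 1}, ‖Matrix.toEuclideanLin M x.1‖

/-- `‖V‖_max = max_i ‖V i‖` (spectral norms). -/
def maxNorm {a b N : ℕ} (V : Fin N → Matrix (Fin a) (Fin b) ℝ) : ℝ :=
  ⨆ i, specNorm (V i)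

/-- `Λ_min(V) = min_i σ_min(V i)`. -/
def lamMin {a N : ℕ} (V : Fin N → Matrix (Fin a) (Fin a) ℝ) : ℝ :=
  ⨅ i, sigmaMin (V i)

/-- `μ = (min_i π i) · σ_min(Sg)`. -/
def mu {d N : ℕ} (piv : Fin N → ℝ) (Sg : Matrix (Fin d) (Fin d) ℝ) : ℝ :=
  (⨅ i, piv i) * sigmaMin Sg

/-- `ξ(α) = (1/Λ_min(Q))·((1 + ‖B‖²_max)·α/μ + ‖R‖_max) − 1`. -/
def xi {d k N : ℕ} (B : Fin N → Matrix (Fin d) (Fin k) ℝ)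
    (R : Fin N → Matrix (Fin k) (Fin k) ℝ) (Q : Fin N → Matrix (Fin d) (Fin d) ℝ)
    (piv : Fin N → ℝ) (Sg : Matrix (Fin d) (Fin d) ℝ) (α : ℝ) : ℝ :=
  (1 / lamMin Q) * ((1 + maxNorm B ^ 2) * α / mu piv Sg + maxNorm R) - 1

/-- The smoothness constant
`L(α) = 2·(‖R‖_max + ‖B‖²_max·(1 + 2ξ(α)/‖B‖_max)·α/μ)·α/Λ_min(Q)`. -/
def Lsm {d k N : ℕ} (B : Fin N → Matrix (Fin d) (Fin k) ℝ)
    (R : Fin N → Matrix (Fin k) (Fin k) ℝ) (Q : Fin N → Matrix (Fin d) (Fin d) ℝ)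
    (piv : Fin N → ℝ) (Sg : Matrix (Fin d) (Fin d) ℝ) (α : ℝ) : ℝ :=
  2 * (maxNorm R + maxNorm B ^ 2 * (1 + 2 * xi B R Q piv Sg α / maxNorm B)
      * α / mu piv Sg) * α / lamMin Q

end

section helpers

/-- `opL` as a linear endomorphism. -/
noncomputable def opLl {d N : ℕ} (Pr : Matrix (Fin N) (Fin N) ℝ)
    (Γ : Fin N → Matrix (Fin d) (Fin d) ℝ) :
    Module.End ℝ (Fin N → Matrix (Fin d) (Fin d) ℝ) where
  toFun := opL Pr Γ
  map_add' V W := by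
    funext i
    simp only [opL, opE, Pi.add_apply, smul_add, Finset.sum_add_distrib, mul_add, add_mul]
  map_smul' c V := by
    funext i
    simp only [opL, opE, Pi.smul_apply, RingHom.id_apply, smul_comm _ c, ← Finset.smul_sum,
      Matrix.mul_smul, Matrix.smul_mul]

theorem opLl_coe {d N : ℕ} (Pr : Matrix (Fin N) (Fin N) ℝ)
    (Γ : Fin N → Matrix (Fin d) (Fin d) ℝ) : ⇑(opLl Pr Γ) = opL Pr Γ := rfl

theorem opLl_pow {d N : ℕ} (Pr : Matrix (Fin N) (Fin N) ℝ)
    (Γ : Fin N → Matrix (Fin d) (Fin d) ℝ) (t : ℕ) : ⇑(opLl Pr Γ ^ t) = (opL Pr Γ)^[t] := by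
  rw [Module.End.coe_pow, opLl_coe]

/-- Vectorization. -/
def vc {d N : ℕ} (V : Fin N → Matrix (Fin d) (Fin d) ℝ) : Fin N × Fin d × Fin d → ℝ :=
  fun p => V p.1 p.2.1 p.2.2

theorem calA_apply {d N : ℕ} (Pr : Matrix (Fin N) (Fin N) ℝ)
    (Γ : Fin N → Matrix (Fin d) (Fin d) ℝ) (i j : Fin N) (a b c e : Fin d) :
    calA Pr Γ (i, a, b) (j, c, e) = Pr i j * (Γ i c a * Γ i e b) := by
  simp only [calA, Matrix.mul_apply, Fintype.sum_prod_type, Matrix.reindex_apply,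
    Matrix.submatrix_apply, Equiv.prodComm_symm, Equiv.prodComm_apply, Prod.swap_prod_mk,
    Matrix.blockDiagonal_apply, Matrix.kroneckerMap_apply, Matrix.transpose_apply,
    Matrix.one_apply, Prod.mk.injEq]
  rw [Finset.sum_eq_single i, Finset.sum_eq_single c, Finset.sum_eq_single e]
  · simp; ring
  · intro x _ hx; simp [hx]
  · simp
  · intro x _ hx; simp [hx]
  · simp
  · intro x _ hx; simp [hx.symm]
  · simp

theorem calA_mulVec {d N : ℕ} (Pr : Matrix (Fin N) (Fin N) ℝ)
    (Γ : Fin N → Matrix (Fin d) (Fin d) ℝ) (V : Fin N → Matrix (Fin d) (Fin d) ℝ) :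
    calA Pr Γ *ᵥ vc V = vc (opL Pr Γ V) := by
  funext ⟨i, a, b⟩
  simp only [Matrix.mulVec, dotProduct, Fintype.sum_prod_type, calA_apply, vc, opL, opE,
    Matrix.mul_apply, Matrix.transpose_apply, Matrix.sum_apply, Matrix.smul_apply, smul_eq_mul,
    Finset.sum_mul, Finset.mul_sum]
  have hl : ∀ F : Fin N → Fin d → Fin d → ℝ,
      ∑ j, ∑ c, ∑ e, F j c e = ∑ e, ∑ j, ∑ c, F j c e := by
    intro F
    conv_rhs => rw [Finset.sum_comm]
    exact Finset.sum_congr rfl fun c _ => Finset.sum_comm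
  rw [hl]
  refine Finset.sum_congr rfl fun e _ => Finset.sum_congr rfl fun j _ =>
    Finset.sum_congr rfl fun c _ => ?_
  ring

theorem vecMul_calA {d N : ℕ} (Pr : Matrix (Fin N) (Fin N) ℝ)
    (Γ : Fin N → Matrix (Fin d) (Fin d) ℝ) (V : Fin N → Matrix (Fin d) (Fin d) ℝ) :
    vc V ᵥ* calA Pr Γ = vc (opT Pr Γ V) := by
  funext ⟨j, c, e⟩
  simp only [Matrix.vecMul, dotProduct, Fintype.sum_prod_type, calA_apply, vc, opT,
    Matrix.mul_apply, Matrix.transpose_apply, Matrix.sum_apply, Matrix.smul_apply, smul_eq_mul,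
    Finset.sum_mul, Finset.mul_sum]
  refine Finset.sum_congr rfl fun i _ => ?_
  rw [Finset.sum_comm]
  refine Finset.sum_congr rfl fun x _ => Finset.sum_congr rfl fun y _ => ?_
  ring

theorem calA_pow_mulVec {d N : ℕ} (Pr : Matrix (Fin N) (Fin N) ℝ)
    (Γ : Fin N → Matrix (Fin d) (Fin d) ℝ) (t : ℕ) (V : Fin N → Matrix (Fin d) (Fin d) ℝ) :
    calA Pr Γ ^ t *ᵥ vc V = vc ((opL Pr Γ)^[t] V) := by
  induction t generalizing V with
  | zero => simp
  | succ t ih =>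
    rw [pow_succ, ← Matrix.mulVec_mulVec, calA_mulVec, ih, Function.iterate_succ_apply]

theorem vecMul_calA_pow {d N : ℕ} (Pr : Matrix (Fin N) (Fin N) ℝ)
    (Γ : Fin N → Matrix (Fin d) (Fin d) ℝ) (t : ℕ) (V : Fin N → Matrix (Fin d) (Fin d) ℝ) :
    vc V ᵥ* calA Pr Γ ^ t = vc ((opT Pr Γ)^[t] V) := by
  induction t generalizing V with
  | zero => simp
  | succ t ih =>
    rw [pow_succ', ← Matrix.vecMul_vecMul, vecMul_calA, ih, Function.iterate_succ_apply]

/-- Entries of powers of a matrix with spectral radius less than one are summable. -/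
theorem summable_entries {n : Type*} [Fintype n] [DecidableEq n] (M : Matrix n n ℝ)
    (h : spectralRadius ℂ (M.map (algebraMap ℝ ℂ)) < 1) (p q : n) :
    Summable fun t : ℕ => |(M ^ t) p q| := by
  let _ : NormedRing (Matrix n n ℂ) := Matrix.linftyOpNormedRing
  let _ : NormedAlgebra ℂ (Matrix n n ℂ) := Matrix.linftyOpNormedAlgebra
  set a := M.map (algebraMap ℝ ℂ) with ha
  have hG := spectrum.pow_nnnorm_pow_one_div_tendsto_nhds_spectralRadius a
  obtain ⟨r, hr1, hr2⟩ := exists_between h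
  have hev := hG.eventually (gt_mem_nhds hr1)
  have hrt : r ≠ ⊤ := (hr2.trans ENNReal.one_lt_top).ne
  lift r to NNReal using hrt
  have hr2' : (r : ℝ) < 1 := by exact_mod_cast hr2
  have hent : ∀ t : ℕ, |(M ^ t) p q| ≤ ‖a ^ t‖ := by
    intro t
    have h1 : a ^ t = (M ^ t).map (algebraMap ℝ ℂ) := by
      rw [ha]
      exact (map_pow (algebraMap ℝ ℂ).mapMatrix M t).symm
    have h2 : |(M ^ t) p q| = ‖(a ^ t) p q‖ := by
      rw [h1]; simp
    rw [h2]
    rw [Matrix.linfty_opNorm_def]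
    have h3 : ‖(a^t) p q‖₊ ≤ Finset.univ.sup fun i => ∑ j, ‖(a^t) i j‖₊ :=
      le_trans (Finset.single_le_sum (f := fun j => ‖(a^t) p j‖₊) (fun _ _ => zero_le) (Finset.mem_univ q))
        (Finset.le_sup (f := fun i => ∑ j, ‖(a^t) i j‖₊) (Finset.mem_univ p))
    exact_mod_cast h3
  refine Summable.of_norm_bounded_eventually_nat (summable_geometric_of_lt_one r.2 hr2') ?_
  filter_upwards [hev, eventually_gt_atTop 0] with t ht ht0
  have h5 : ‖a ^ t‖ ≤ (r : ℝ) ^ t := by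
    have h6 : (‖a ^ t‖₊ : ENNReal) ≤ (r : ENNReal) ^ t := by
      have := ENNReal.rpow_le_rpow ht.le (z := (t : ℝ)) (by positivity)
      rw [← ENNReal.rpow_mul, one_div, inv_mul_cancel₀ (by positivity), ENNReal.rpow_one,
        ENNReal.rpow_natCast] at this
      exact this
    exact_mod_cast h6
  rw [Real.norm_eq_abs, abs_abs]
  exact (hent t).trans h5

/-- Stability: iterates of `opL` converge to zero entrywise. -/
def Stab {d N : ℕ} (Pr : Matrix (Fin N) (Fin N) ℝ)
    (Γ : Fin N → Matrix (Fin d) (Fin d) ℝ) : Prop :=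
  ∀ V i a b, Tendsto (fun t => (opL Pr Γ)^[t] V i a b) atTop (𝓝 0)

theorem stab_of_MSS {d k N : ℕ} {Pr : Matrix (Fin N) (Fin N) ℝ}
    {A : Fin N → Matrix (Fin d) (Fin d) ℝ} {B : Fin N → Matrix (Fin d) (Fin k) ℝ}
    {K : Fin N → Matrix (Fin k) (Fin d) ℝ} (h : MSS Pr A B K) : Stab Pr (Gam A B K) := by
  intro V i a b
  have h1 : (fun t => (opL Pr (Gam A B K))^[t] V i a b) =
      fun t => ∑ q, (calA Pr (Gam A B K) ^ t) (i, a, b) q * vc V q := by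
    funext t
    exact (congrFun (calA_pow_mulVec Pr (Gam A B K) t V) (i, a, b)).symm
  rw [h1, show (0 : ℝ) = ∑ q : Fin N × Fin d × Fin d, 0 * vc V q by simp]
  refine tendsto_finsetSum _ fun q _ => Tendsto.mul_const _ ?_
  exact (summable_abs_iff.mp (summable_entries _ h (i, a, b) q)).tendsto_atTop_zero

theorem summable_T {d k N : ℕ} {Pr : Matrix (Fin N) (Fin N) ℝ}
    {A : Fin N → Matrix (Fin d) (Fin d) ℝ} {B : Fin N → Matrix (Fin d) (Fin k) ℝ}
    {K : Fin N → Matrix (Fin k) (Fin d) ℝ} (h : MSS Pr A B K)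
    (V : Fin N → Matrix (Fin d) (Fin d) ℝ) :
    Summable fun t : ℕ => (opT Pr (Gam A B K))^[t] V := by
  refine Pi.summable.mpr fun i => Pi.summable.mpr fun a => Pi.summable.mpr fun b => ?_
  have h1 : (fun t => (opT Pr (Gam A B K))^[t] V i a b) =
      fun t => ∑ q, vc V q * (calA Pr (Gam A B K) ^ t) q (i, a, b) := by
    funext t
    exact (congrFun (vecMul_calA_pow Pr (Gam A B K) t V) (i, a, b)).symm
  rw [h1]
  exact summable_sum fun q _ => Summable.mul_left _
    (summable_abs_iff.mp (summable_entries _ h q (i, a, b)))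

open scoped MatrixOrder in
theorem psd_lower {n : ℕ} {M : Matrix (Fin n) (Fin n) ℝ} (hM : M.IsHermitian) {c : ℝ}
    (h : ∀ i, c ≤ hM.eigenvalues i) : (M - c • 1).PosSemidef := by
  have h1 : algebraMap ℝ _ c ≤ M := by
    rw [algebraMap_le_iff_le_spectrum (ha := hM), hM.spectrum_real_eq_range_eigenvalues]
    rintro _ ⟨i, rfl⟩
    exact h i
  rw [Algebra.algebraMap_eq_smul_one] at h1
  exact h1

open scoped MatrixOrder in
theorem psd_upper {n : ℕ} {M : Matrix (Fin n) (Fin n) ℝ} (hM : M.IsHermitian) {c : ℝ}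
    (h : ∀ i, hM.eigenvalues i ≤ c) : (c • 1 - M).PosSemidef := by
  have h1 : M ≤ algebraMap ℝ _ c := by
    rw [le_algebraMap_iff_spectrum_le (ha := hM), hM.spectrum_real_eq_range_eigenvalues]
    rintro _ ⟨i, rfl⟩
    exact h i
  rw [Algebra.algebraMap_eq_smul_one] at h1
  exact h1

theorem norm_eig {n : ℕ} {M : Matrix (Fin n) (Fin n) ℝ} (hM : M.IsHermitian) (i : Fin n) :
    ‖Matrix.toEuclideanLin M (hM.eigenvectorBasis i)‖ = |hM.eigenvalues i| := by
  have h : Matrix.toEuclideanLin M (hM.eigenvectorBasis i)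
      = hM.eigenvalues i • hM.eigenvectorBasis i := by
    rw [Matrix.toEuclideanLin, Matrix.toLpLin_apply, hM.mulVec_eigenvectorBasis]
    rfl
  rw [h, norm_smul, hM.eigenvectorBasis.orthonormal.1 i]
  simp

theorem sigmaMin_nonneg {n : ℕ} (M : Matrix (Fin n) (Fin n) ℝ) : 0 ≤ sigmaMin M :=
  Real.iInf_nonneg fun _ => norm_nonneg _

theorem sigmaMin_psd {n : ℕ} {M : Matrix (Fin n) (Fin n) ℝ} (hM : M.PosSemidef) :
    (M - sigmaMin M • 1).PosSemidef := by
  refine psd_lower hM.1 fun i => ?_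
  rw [← abs_of_nonneg (hM.eigenvalues_nonneg i), ← norm_eig]
  exact ciInf_le (f := fun x : {x : EuclideanSpace ℝ (Fin n) // ‖x‖ = 1} =>
    ‖Matrix.toEuclideanLin M x.1‖) ⟨0, by rintro _ ⟨x, rfl⟩; exact norm_nonneg _⟩
    ⟨_, hM.1.eigenvectorBasis.orthonormal.1 i⟩

theorem specNorm_nonneg {m n : ℕ} (M : Matrix (Fin m) (Fin n) ℝ) : 0 ≤ specNorm M :=
  Real.iSup_nonneg fun _ => norm_nonneg _

theorem specNorm_psd {n : ℕ} {M : Matrix (Fin n) (Fin n) ℝ} (hM : M.IsHermitian) :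
    (specNorm M • 1 - M).PosSemidef := by
  refine psd_upper hM fun i => ?_
  refine (le_abs_self _).trans ?_
  rw [← norm_eig]
  refine le_ciSup (f := fun x : {x : EuclideanSpace ℝ (Fin n) // ‖x‖ ≤ 1} =>
    ‖Matrix.toEuclideanLin M x.1‖) ?_ ⟨_, (hM.eigenvectorBasis.orthonormal.1 i).le⟩
  refine ⟨‖LinearMap.toContinuousLinearMap (Matrix.toEuclideanLin M)‖, ?_⟩
  rintro _ ⟨x, rfl⟩
  exact (LinearMap.toContinuousLinearMap (Matrix.toEuclideanLin M)).unit_le_opNorm x.1 x.2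

theorem smul_one_psd {n : ℕ} {c : ℝ} (h : 0 ≤ c) :
    (c • (1 : Matrix (Fin n) (Fin n) ℝ)).PosSemidef := Matrix.PosSemidef.one.smul h

theorem posDef_lower {n : ℕ} {M : Matrix (Fin n) (Fin n) ℝ} (hM : M.PosDef) :
    ∃ q : ℝ, 0 < q ∧ (M - q • 1).PosSemidef := by
  rcases isEmpty_or_nonempty (Fin n) with h | h
  · exact ⟨1, one_pos, psd_lower hM.1 fun i => (h.false i).elim⟩
  · obtain ⟨i, hi⟩ := Finite.exists_min hM.1.eigenvalues
    exact ⟨_, hM.eigenvalues_pos i, psd_lower hM.1 hi⟩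

open scoped MatrixOrder in
theorem trace_mul_nonneg {n : ℕ} {M X : Matrix (Fin n) (Fin n) ℝ} (hM : M.PosSemidef)
    (hX : X.PosSemidef) : 0 ≤ (M * X).trace := by
  obtain ⟨G, rfl⟩ := CStarAlgebra.nonneg_iff_eq_star_mul_self.mp hM.nonneg
  rw [Matrix.star_eq_conjTranspose, Matrix.mul_assoc, Matrix.trace_mul_comm]
  exact (hX.mul_mul_conjTranspose_same G).trace_nonneg

theorem psd_conj {m n : ℕ} {M : Matrix (Fin n) (Fin n) ℝ} (hM : M.PosSemidef)
    (G : Matrix (Fin n) (Fin m) ℝ) : (Gᵀ * M * G).PosSemidef := by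
  rw [← Matrix.conjTranspose_eq_transpose_of_trivial]
  exact hM.conjTranspose_mul_mul_same G

theorem psd_conj' {m n : ℕ} {M : Matrix (Fin n) (Fin n) ℝ} (hM : M.PosSemidef)
    (G : Matrix (Fin m) (Fin n) ℝ) : (G * M * Gᵀ).PosSemidef := by
  rw [← Matrix.conjTranspose_eq_transpose_of_trivial]
  exact hM.mul_mul_conjTranspose_same G

theorem psd_gram {m n : ℕ} (G : Matrix (Fin m) (Fin n) ℝ) : (Gᵀ * G).PosSemidef := by
  rw [← Matrix.conjTranspose_eq_transpose_of_trivial]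
  exact Matrix.posSemidef_conjTranspose_mul_self G

theorem psd_of_tendsto {n : ℕ} {M : Matrix (Fin n) (Fin n) ℝ} {f : ℕ → Matrix (Fin n) (Fin n) ℝ}
    (hf : ∀ t, (f t).PosSemidef)
    (h : ∀ a b, Tendsto (fun t => f t a b) atTop (𝓝 (M a b))) : M.PosSemidef := by
  refine Matrix.PosSemidef.of_dotProduct_mulVec_nonneg ?_ fun x => ?_
  · ext a b
    have h1 : (fun t => f t b a) = fun t => f t a b := by
      funext t
      have := (hf t).1.apply a b
      simpa using this
    have h2 := h b a
    rw [h1] at h2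
    simpa using tendsto_nhds_unique h2 (h a b)
  · refine ge_of_tendsto' (f := fun t => star x ⬝ᵥ f t *ᵥ x) (x := atTop) ?_
      fun t => (hf t).dotProduct_mulVec_nonneg x
    simp only [dotProduct, Matrix.mulVec]
    exact tendsto_finsetSum _ fun a _ => Tendsto.const_mul _
      (tendsto_finsetSum _ fun b _ => Tendsto.mul_const _ (h a b))

theorem opE_psd {d N : ℕ} {Pr : Matrix (Fin N) (Fin N) ℝ} (hPr : ∀ i j, 0 ≤ Pr i j)
    {V : Fin N → Matrix (Fin d) (Fin d) ℝ}
    (hV : ∀ i, (V i).PosSemidef) (i : Fin N) : (opE Pr V i).PosSemidef :=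
  Matrix.posSemidef_sum _ fun j _ => (hV j).smul (hPr i j)

theorem opL_psd {d N : ℕ} {Pr : Matrix (Fin N) (Fin N) ℝ} (hPr : ∀ i j, 0 ≤ Pr i j)
    (Γ : Fin N → Matrix (Fin d) (Fin d) ℝ) {V : Fin N → Matrix (Fin d) (Fin d) ℝ}
    (hV : ∀ i, (V i).PosSemidef) (t : ℕ) : ∀ i, ((opL Pr Γ)^[t] V i).PosSemidef := by
  induction t with
  | zero => exact hV
  | succ t ih =>
    intro i
    rw [Function.iterate_succ_apply']
    exact psd_conj (opE_psd hPr ih i) _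

theorem opT_psd {d N : ℕ} {Pr : Matrix (Fin N) (Fin N) ℝ} (hPr : ∀ i j, 0 ≤ Pr i j)
    (Γ : Fin N → Matrix (Fin d) (Fin d) ℝ) {V : Fin N → Matrix (Fin d) (Fin d) ℝ}
    (hV : ∀ i, (V i).PosSemidef) (t : ℕ) : ∀ i, ((opT Pr Γ)^[t] V i).PosSemidef := by
  induction t with
  | zero => exact hV
  | succ t ih =>
    intro i
    rw [Function.iterate_succ_apply']
    exact Matrix.posSemidef_sum _ fun j _ => (psd_conj' (ih j) _).smul (hPr j i)

/-- `V - L^t V = ∑_{s<t} L^s (V - L V)`. -/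
theorem telescope {d N : ℕ} (Pr : Matrix (Fin N) (Fin N) ℝ)
    (Γ : Fin N → Matrix (Fin d) (Fin d) ℝ) (V : Fin N → Matrix (Fin d) (Fin d) ℝ) (t : ℕ) :
    V - (opL Pr Γ)^[t] V = ∑ s ∈ Finset.range t, (opL Pr Γ)^[s] (V - opL Pr Γ V) := by
  induction t with
  | zero => simp
  | succ t ih =>
    rw [Finset.sum_range_succ, ← ih, ← opLl_pow Pr Γ t, map_sub, opLl_pow,
      Function.iterate_succ_apply]
    abel

theorem psd_of_stab {d N : ℕ} {Pr : Matrix (Fin N) (Fin N) ℝ} (hPr : ∀ i j, 0 ≤ Pr i j)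
    {Γ : Fin N → Matrix (Fin d) (Fin d) ℝ} (hS : Stab Pr Γ)
    {V : Fin N → Matrix (Fin d) (Fin d) ℝ} (h : ∀ i, (V i - opL Pr Γ V i).PosSemidef) :
    ∀ i, (V i).PosSemidef := by
  intro i
  refine psd_of_tendsto (f := fun t => (V - (opL Pr Γ)^[t] V) i) (fun t => ?_) fun a b => ?_
  · rw [telescope, Finset.sum_apply]
    exact Matrix.posSemidef_sum _ fun s _ => opL_psd hPr Γ (V := V - opL Pr Γ V) h s i
  · have := (hS V i a b).const_sub (V i a b)
    simpa using this

theorem exists_sol {d N : ℕ} {Pr : Matrix (Fin N) (Fin N) ℝ}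
    {Γ : Fin N → Matrix (Fin d) (Fin d) ℝ} (hS : Stab Pr Γ)
    (W : Fin N → Matrix (Fin d) (Fin d) ℝ) : ∃ V, V = W + opL Pr Γ V := by
  have hinj : Function.Injective
      ⇑((1 : Module.End ℝ (Fin N → Matrix (Fin d) (Fin d) ℝ)) - opLl Pr Γ) := by
    rw [injective_iff_map_eq_zero]
    intro V hV
    have h1 : opL Pr Γ V = V := by
      have : V - opL Pr Γ V = 0 := hV
      exact (sub_eq_zero.mp this).symm
    funext i
    ext a b
    have := hS V i a b
    simp only [Function.iterate_fixed h1] at this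
    exact tendsto_nhds_unique tendsto_const_nhds this
  obtain ⟨V, hV⟩ := (LinearMap.injective_iff_surjective.mp hinj) W
  refine ⟨V, ?_⟩
  have : V - opL Pr Γ V = W := hV
  rw [← this]; abel

theorem PK_isLyap {d k N : ℕ} {Pr : Matrix (Fin N) (Fin N) ℝ}
    {A : Fin N → Matrix (Fin d) (Fin d) ℝ} {B : Fin N → Matrix (Fin d) (Fin k) ℝ}
    (Q : Fin N → Matrix (Fin d) (Fin d) ℝ) (R : Fin N → Matrix (Fin k) (Fin k) ℝ)
    {K : Fin N → Matrix (Fin k) (Fin d) ℝ} (hS : Stab Pr (Gam A B K)) :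
    IsLyap Pr A B Q R K (PK Pr A B Q R K) := by
  have h : ∃ P, IsLyap Pr A B Q R K P := by
    obtain ⟨V, hV⟩ := exists_sol hS (fun i => Q i + (K i)ᵀ * R i * K i)
    exact ⟨V, fun i => congrFun hV i⟩
  rw [PK, dif_pos h]
  exact h.choose_spec

theorem bl_opL {d N : ℕ} (Pr : Matrix (Fin N) (Fin N) ℝ)
    (Γ : Fin N → Matrix (Fin d) (Fin d) ℝ) (V : Fin N → Matrix (Fin d) (Fin d) ℝ) (i : Fin N)
    (x y : Fin d → ℝ) : x ⬝ᵥ opL Pr Γ V i *ᵥ y =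
      ∑ j, Pr i j * ((Γ i *ᵥ x) ⬝ᵥ V j *ᵥ (Γ i *ᵥ y)) := by
  rw [opL, ← Matrix.mulVec_mulVec, ← Matrix.mulVec_mulVec, Matrix.dotProduct_mulVec,
    Matrix.vecMul_transpose, opE, Matrix.sum_mulVec, dotProduct_sum]
  refine Finset.sum_congr rfl fun j _ => ?_
  rw [Matrix.smul_mulVec, dotProduct_smul, smul_eq_mul]

theorem bl_iter {d N : ℕ} {Pr : Matrix (Fin N) (Fin N) ℝ} (hPr : ∀ i j, 0 ≤ Pr i j)
    (Γ : Fin N → Matrix (Fin d) (Fin d) ℝ) (V Q : Fin N → Matrix (Fin d) (Fin d) ℝ) (c : ℝ)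
    (h : ∀ i x y, |x ⬝ᵥ V i *ᵥ y| ≤ c * (x ⬝ᵥ Q i *ᵥ x + y ⬝ᵥ Q i *ᵥ y)) (t : ℕ) :
    ∀ i x y, |x ⬝ᵥ (opL Pr Γ)^[t] V i *ᵥ y| ≤
      c * (x ⬝ᵥ (opL Pr Γ)^[t] Q i *ᵥ x + y ⬝ᵥ (opL Pr Γ)^[t] Q i *ᵥ y) := by
  induction t with
  | zero => exact h
  | succ t ih =>
    intro i x y
    rw [Function.iterate_succ_apply', Function.iterate_succ_apply', bl_opL, bl_opL, bl_opL,
      ← Finset.sum_add_distrib, Finset.mul_sum]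
    refine (Finset.abs_sum_le_sum_abs _ _).trans (Finset.sum_le_sum fun j _ => ?_)
    rw [abs_mul, abs_of_nonneg (hPr i j)]
    have := mul_le_mul_of_nonneg_left (ih j (Γ i *ᵥ x) (Γ i *ᵥ y)) (hPr i j)
    linarith

theorem bl_bound {n : ℕ} (M : Matrix (Fin n) (Fin n) ℝ) (x y : Fin n → ℝ) :
    |x ⬝ᵥ M *ᵥ y| ≤ (∑ a, ∑ b, |M a b|) * (x ⬝ᵥ x + y ⬝ᵥ y) := by
  simp only [Matrix.mulVec, dotProduct, Finset.mul_sum]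
  refine (Finset.abs_sum_le_sum_abs _ _).trans ?_
  simp only [Finset.sum_mul]
  refine Finset.sum_le_sum fun a _ => ?_
  refine (Finset.abs_sum_le_sum_abs _ _).trans (Finset.sum_le_sum fun b _ => ?_)
  have hx : x a * x a ≤ ∑ i, x i * x i :=
    Finset.single_le_sum (f := fun i => x i * x i) (fun i _ => mul_self_nonneg _) (Finset.mem_univ a)
  have hy : y b * y b ≤ ∑ i, y i * y i :=
    Finset.single_le_sum (f := fun i => y i * y i) (fun i _ => mul_self_nonneg _) (Finset.mem_univ b)
  rw [abs_mul, abs_mul]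
  have h1 : |x a| * |y b| ≤ ∑ i, x i * x i + ∑ i, y i * y i := by
    have h2 := sq_nonneg (|x a| - |y b|)
    have h3 := abs_mul_abs_self (x a)
    have h4 := abs_mul_abs_self (y b)
    nlinarith [mul_self_nonneg (x a), mul_self_nonneg (y b)]
  calc |x a| * (|M a b| * |y b|) = |M a b| * (|x a| * |y b|) := by ring
    _ ≤ _ := mul_le_mul_of_nonneg_left h1 (abs_nonneg _)

theorem stab_of_ineq {d N : ℕ} {Pr : Matrix (Fin N) (Fin N) ℝ} (hPr : ∀ i j, 0 ≤ Pr i j)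
    {Γ : Fin N → Matrix (Fin d) (Fin d) ℝ} {P Q : Fin N → Matrix (Fin d) (Fin d) ℝ}
    (hQ : ∀ i, (Q i).PosDef) (hP : ∀ i, (P i).PosSemidef)
    (h : ∀ i, (P i - opL Pr Γ P i - Q i).PosSemidef) : Stab Pr Γ := by
  have hsum : ∀ i x, Tendsto (fun t => x ⬝ᵥ (opL Pr Γ)^[t] Q i *ᵥ x) atTop (𝓝 0) := by
    intro i x
    refine (summable_of_sum_range_le (c := x ⬝ᵥ P i *ᵥ x) (fun t => ?_)
      fun t => ?_).tendsto_atTop_zero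
    · exact (opL_psd hPr Γ (fun i => (hQ i).posSemidef) t i).dotProduct_mulVec_nonneg x
    · have h1 := congrFun (telescope Pr Γ P t) i
      have h2 : ∀ s, (opL Pr Γ)^[s] (P - opL Pr Γ P) = (opL Pr Γ)^[s] (P - opL Pr Γ P - Q)
          + (opL Pr Γ)^[s] Q := by
        intro s
        rw [← opLl_pow, ← map_add, sub_add_cancel]
      simp only [h2, Finset.sum_add_distrib] at h1
      have h3 : P i = (opL Pr Γ)^[t] P i
          + ∑ s ∈ Finset.range t, (opL Pr Γ)^[s] (P - opL Pr Γ P - Q) i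
          + ∑ s ∈ Finset.range t, (opL Pr Γ)^[s] Q i := by
        simp only [Pi.sub_apply, Pi.add_apply, Finset.sum_apply] at h1
        rw [add_assoc, ← h1]; abel
      have h4 := (opL_psd hPr Γ hP t i).dotProduct_mulVec_nonneg x
      have h5 := (Matrix.posSemidef_sum (Finset.range t) fun s _ =>
        opL_psd hPr Γ (V := P - opL Pr Γ P - Q) h s i).dotProduct_mulVec_nonneg x
      have h6 : ∑ s ∈ Finset.range t, x ⬝ᵥ (opL Pr Γ)^[s] Q i *ᵥ x =
          x ⬝ᵥ (∑ s ∈ Finset.range t, (opL Pr Γ)^[s] Q i) *ᵥ x := by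
        rw [Matrix.sum_mulVec, dotProduct_sum]
      rw [h6, h3, Matrix.add_mulVec, Matrix.add_mulVec, dotProduct_add, dotProduct_add]
      simp only [star_trivial] at h4 h5
      linarith
  choose q hq0 hq using fun i => posDef_lower (hQ i)
  intro V i a b
  have hb : ∃ c, ∀ i x y, |x ⬝ᵥ V i *ᵥ y| ≤ c * (x ⬝ᵥ Q i *ᵥ x + y ⬝ᵥ Q i *ᵥ y) := by
    refine ⟨∑ i, (∑ a, ∑ b, |V i a b|) / q i, fun i x y => ?_⟩
    have hx : ∀ x : Fin d → ℝ, q i * (x ⬝ᵥ x) ≤ x ⬝ᵥ Q i *ᵥ x := by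
      intro x
      have := (hq i).dotProduct_mulVec_nonneg x
      rw [Matrix.sub_mulVec, dotProduct_sub, Matrix.smul_mulVec, Matrix.one_mulVec,
        dotProduct_smul, smul_eq_mul, star_trivial] at this
      linarith
    have h0 : ∀ i, 0 ≤ (∑ a, ∑ b, |V i a b|) / q i := fun i =>
      div_nonneg (Finset.sum_nonneg fun _ _ => Finset.sum_nonneg fun _ _ => abs_nonneg _)
        (hq0 i).le
    have h1 : 0 ≤ x ⬝ᵥ Q i *ᵥ x + y ⬝ᵥ Q i *ᵥ y :=
      add_nonneg ((hQ i).posSemidef.dotProduct_mulVec_nonneg x)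
        ((hQ i).posSemidef.dotProduct_mulVec_nonneg y)
    calc |x ⬝ᵥ V i *ᵥ y| ≤ (∑ a, ∑ b, |V i a b|) * (x ⬝ᵥ x + y ⬝ᵥ y) := bl_bound _ _ _
      _ = (∑ a, ∑ b, |V i a b|) / q i * (q i * (x ⬝ᵥ x) + q i * (y ⬝ᵥ y)) := by
        have := (hq0 i).ne'
        field_simp
      _ ≤ (∑ a, ∑ b, |V i a b|) / q i * (x ⬝ᵥ Q i *ᵥ x + y ⬝ᵥ Q i *ᵥ y) :=
        mul_le_mul_of_nonneg_left (add_le_add (hx x) (hx y)) (h0 i)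
      _ ≤ _ := mul_le_mul_of_nonneg_right
        (Finset.single_le_sum (f := fun i => (∑ a, ∑ b, |V i a b|) / q i) (fun i _ => h0 i)
          (Finset.mem_univ i)) h1
  obtain ⟨c, hc⟩ := hb
  have hit := fun t => bl_iter hPr Γ V Q c hc t i (Pi.single a 1) (Pi.single b 1)
  have hlim := ((hsum i (Pi.single a 1)).add (hsum i (Pi.single b 1))).const_mul c
  rw [add_zero, mul_zero] at hlim
  refine squeeze_zero_norm (fun t => ?_) hlim
  have := hit t
  simpa using this

/-- The trace pairing. -/
noncomputable def tp {d N : ℕ} (V W : Fin N → Matrix (Fin d) (Fin d) ℝ) : ℝ :=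
  ∑ i, (V i * W i).trace

theorem tp_add_left {d N : ℕ} (V V' W : Fin N → Matrix (Fin d) (Fin d) ℝ) :
    tp (V + V') W = tp V W + tp V' W := by
  simp [tp, Matrix.add_mul, Finset.sum_add_distrib]

theorem tp_add_right {d N : ℕ} (V W W' : Fin N → Matrix (Fin d) (Fin d) ℝ) :
    tp V (W + W') = tp V W + tp V W' := by
  simp [tp, Matrix.mul_add, Finset.sum_add_distrib]

theorem tp_dual {d N : ℕ} (Pr : Matrix (Fin N) (Fin N) ℝ)
    (Γ : Fin N → Matrix (Fin d) (Fin d) ℝ) (V W : Fin N → Matrix (Fin d) (Fin d) ℝ) :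
    tp (opL Pr Γ V) W = tp V (opT Pr Γ W) := by
  simp only [tp, opL, opE, opT, Finset.mul_sum, Finset.sum_mul, Matrix.trace_sum]
  rw [Finset.sum_comm]
  refine Finset.sum_congr rfl fun j _ => Finset.sum_congr rfl fun i _ => ?_
  simp only [Matrix.mul_smul, Matrix.smul_mul, Matrix.trace_smul]
  congr 1
  rw [Matrix.mul_assoc, Matrix.mul_assoc, Matrix.trace_mul_comm]
  simp only [Matrix.mul_assoc]

theorem tp_nonneg {d N : ℕ} {V W : Fin N → Matrix (Fin d) (Fin d) ℝ}
    (hV : ∀ i, (V i).PosSemidef) (hW : ∀ i, (W i).PosSemidef) : 0 ≤ tp V W :=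
  Finset.sum_nonneg fun i _ => trace_mul_nonneg (hV i) (hW i)

theorem tp_mono_left {d N : ℕ} {V V' W : Fin N → Matrix (Fin d) (Fin d) ℝ}
    (hV : ∀ i, (V' i - V i).PosSemidef) (hW : ∀ i, (W i).PosSemidef) : tp V W ≤ tp V' W := by
  have h := tp_nonneg (V := V' - V) hV hW
  have h2 := tp_add_left (V' - V) V W
  rw [sub_add_cancel] at h2
  linarith

theorem tp_mono_right {d N : ℕ} {V W W' : Fin N → Matrix (Fin d) (Fin d) ℝ}
    (hV : ∀ i, (V i).PosSemidef) (hW : ∀ i, (W' i - W i).PosSemidef) : tp V W ≤ tp V W' := by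
  have h := tp_nonneg (W := W' - W) hV hW
  have h2 := tp_add_right V (W' - W) W
  rw [sub_add_cancel] at h2
  linarith

theorem cost_eq {d k N : ℕ} (Pr : Matrix (Fin N) (Fin N) ℝ)
    (A : Fin N → Matrix (Fin d) (Fin d) ℝ) (B : Fin N → Matrix (Fin d) (Fin k) ℝ)
    (Q : Fin N → Matrix (Fin d) (Fin d) ℝ) (R : Fin N → Matrix (Fin k) (Fin k) ℝ)
    (piv : Fin N → ℝ) (Sg : Matrix (Fin d) (Fin d) ℝ)
    (K : Fin N → Matrix (Fin k) (Fin d) ℝ) :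
    cost Pr A B Q R piv Sg K = tp (PK Pr A B Q R K) (fun i => piv i • Sg) := by
  simp [cost, tp]

theorem continuous_opT {d N : ℕ} (Pr : Matrix (Fin N) (Fin N) ℝ)
    (Γ : Fin N → Matrix (Fin d) (Fin d) ℝ) : Continuous (opT Pr Γ) := by
  unfold opT
  fun_prop

theorem XK_eq {d k N : ℕ} {Pr : Matrix (Fin N) (Fin N) ℝ}
    {A : Fin N → Matrix (Fin d) (Fin d) ℝ} {B : Fin N → Matrix (Fin d) (Fin k) ℝ}
    {K : Fin N → Matrix (Fin k) (Fin d) ℝ} (h : MSS Pr A B K)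
    (piv : Fin N → ℝ) (Sg : Matrix (Fin d) (Fin d) ℝ) :
    XK Pr piv Sg (Gam A B K) = (fun i => piv i • Sg)
      + opT Pr (Gam A B K) (XK Pr piv Sg (Gam A B K)) := by
  set Γ := Gam A B K
  let T : (Fin N → Matrix (Fin d) (Fin d) ℝ) →+ (Fin N → Matrix (Fin d) (Fin d) ℝ) :=
    { toFun := opT Pr Γ
      map_zero' := by funext i; simp [opT]
      map_add' := fun V W => by
        funext i
        simp [opT, Matrix.mul_add, Matrix.add_mul, Finset.sum_add_distrib] }
  have hs := summable_T h (fun i => piv i • Sg)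
  have h1 := hs.hasSum.map T (continuous_opT Pr Γ)
  have h2 := hs.hasSum
  rw [hasSum_nat_add_iff' 1 |>.symm] at h2
  have h3 : (⇑T ∘ fun t => (opT Pr Γ)^[t] (fun i => piv i • Sg))
      = fun t => (opT Pr Γ)^[t+1] (fun i => piv i • Sg) := by
    funext t
    rw [Function.iterate_succ_apply']; rfl
  rw [h3] at h1
  have h4 := h1.unique h2
  simp only [Finset.sum_range_one, Function.iterate_zero, id] at h4
  change opT Pr Γ (XK Pr piv Sg Γ) = XK Pr piv Sg Γ - _ at h4
  rw [h4]; abel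

theorem XK_psd {d k N : ℕ} {Pr : Matrix (Fin N) (Fin N) ℝ} (hPr : ∀ i j, 0 ≤ Pr i j)
    {A : Fin N → Matrix (Fin d) (Fin d) ℝ} {B : Fin N → Matrix (Fin d) (Fin k) ℝ}
    {K : Fin N → Matrix (Fin k) (Fin d) ℝ} (h : MSS Pr A B K)
    {piv : Fin N → ℝ} (hpiv : ∀ i, 0 < piv i) {Sg : Matrix (Fin d) (Fin d) ℝ} (hSg : Sg.PosDef)
    (i : Fin N) : (XK Pr piv Sg (Gam A B K) i).PosSemidef := by
  have hs := (summable_T h (fun i => piv i • Sg)).hasSum.tendsto_sum_nat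
  refine psd_of_tendsto (f := fun n => (∑ t ∈ Finset.range n,
    (opT Pr (Gam A B K))^[t] (fun i => piv i • Sg)) i) (fun n => ?_) fun a b => ?_
  · rw [Finset.sum_apply]
    exact Matrix.posSemidef_sum _ fun t _ =>
      opT_psd hPr _ (fun i => hSg.posSemidef.smul (hpiv i).le) t i
  · exact tendsto_pi_nhds.mp (tendsto_pi_nhds.mp (tendsto_pi_nhds.mp hs i) a) b

/-- Policy comparison identity. -/
theorem lyap_diff {d k N : ℕ} {Pr : Matrix (Fin N) (Fin N) ℝ}
    {A : Fin N → Matrix (Fin d) (Fin d) ℝ} {B : Fin N → Matrix (Fin d) (Fin k) ℝ}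
    {Q : Fin N → Matrix (Fin d) (Fin d) ℝ} {R : Fin N → Matrix (Fin k) (Fin k) ℝ}
    {K : Fin N → Matrix (Fin k) (Fin d) ℝ}
    (h : IsLyap Pr A B Q R K (PK Pr A B Q R K)) (hR : ∀ i, (R i)ᵀ = R i)
    (hE : ∀ i, (opE Pr (PK Pr A B Q R K) i)ᵀ = opE Pr (PK Pr A B Q R K) i)
    (D : Fin N → Matrix (Fin k) (Fin d) ℝ) (i : Fin N) :
    PK Pr A B Q R K i - opL Pr (Gam A B (K + D)) (PK Pr A B Q R K) i
      = Q i + (K i + D i)ᵀ * R i * (K i + D i)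
        - ((D i)ᵀ * LK Pr A B Q R K i + (LK Pr A B Q R K i)ᵀ * D i
          + (D i)ᵀ * (R i + (B i)ᵀ * opE Pr (PK Pr A B Q R K) i * B i) * D i) := by
  have h1 := h i
  have h2 := hE i
  conv_lhs => enter [1]; rw [h1]
  simp only [opL, LK, Gam, Pi.add_apply]
  generalize opE Pr (PK Pr A B Q R K) i = E at *
  simp only [Matrix.transpose_add, Matrix.transpose_sub, Matrix.transpose_mul, hR i, h2,
    Matrix.transpose_transpose, Matrix.mul_add, Matrix.add_mul, Matrix.mul_sub, Matrix.sub_mul,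
    Matrix.mul_assoc]
  abel

theorem tp_smul_left {d N : ℕ} (c : ℝ) (V W : Fin N → Matrix (Fin d) (Fin d) ℝ) :
    tp (c • V) W = c * tp V W := by
  simp [tp, Finset.mul_sum]

theorem tp_smul_right {d N : ℕ} (c : ℝ) (V W : Fin N → Matrix (Fin d) (Fin d) ℝ) :
    tp V (c • W) = c * tp V W := by
  simp [tp, Finset.mul_sum]

theorem opL_sub {d N : ℕ} (Pr : Matrix (Fin N) (Fin N) ℝ)
    (Γ : Fin N → Matrix (Fin d) (Fin d) ℝ) (V W : Fin N → Matrix (Fin d) (Fin d) ℝ) :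
    opL Pr Γ (V - W) = opL Pr Γ V - opL Pr Γ W := map_sub (opLl Pr Γ) V W

/-- The decrement `-(Dᵀ L + Lᵀ D + Dᵀ S D)`. -/
noncomputable def decr {d k N : ℕ} (S : Fin N → Matrix (Fin k) (Fin k) ℝ)
    (L D : Fin N → Matrix (Fin k) (Fin d) ℝ) : Fin N → Matrix (Fin d) (Fin d) ℝ :=
  fun i => -((D i)ᵀ * L i + (L i)ᵀ * D i + (D i)ᵀ * S i * D i)

end helpers

/-- one-step contraction of the natural policy gradient method. -/
theorem natural_pg_one_step_contraction
    (d k N : ℕ) (hd : 0 < d) (hk : 0 < k) (hN : 0 < N)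
    (A : Fin N → Matrix (Fin d) (Fin d) ℝ) (B : Fin N → Matrix (Fin d) (Fin k) ℝ)
    (Pr : Matrix (Fin N) (Fin N) ℝ)
    (hPr : ∀ i j, 0 ≤ Pr i j) (hPrSum : ∀ i, ∑ j, Pr i j = 1)
    (piv : Fin N → ℝ) (hpiv : ∀ i, 0 < piv i) (hpivSum : ∑ i, piv i = 1)
    (Sg : Matrix (Fin d) (Fin d) ℝ) (hSg : Sg.PosDef)
    (Q : Fin N → Matrix (Fin d) (Fin d) ℝ) (hQ : ∀ i, (Q i).PosDef)
    (R : Fin N → Matrix (Fin k) (Fin k) ℝ) (hR : ∀ i, (R i).PosDef)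
    (K : Fin N → Matrix (Fin k) (Fin d) ℝ) (hK : MSS Pr A B K)
    (η : ℝ) (hη0 : 0 < η)
    (hη : η ≤ 1 / (2 * ⨆ i, specNorm (R i + (B i)ᵀ * opE Pr (PK Pr A B Q R K) i * B i)))
    (Ks : Fin N → Matrix (Fin k) (Fin d) ℝ) (hKs : MSS Pr A B Ks)
    (hopt : ∀ K' : Fin N → Matrix (Fin k) (Fin d) ℝ, MSS Pr A B K' → cost Pr A B Q R piv Sg Ks ≤ cost Pr A B Q R piv Sg K') :
    cost Pr A B Q R piv Sg (K - (2 * η) • LK Pr A B Q R K) - cost Pr A B Q R piv Sg Ks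
      ≤ (1 - 2 * mu piv Sg * lamMin R * η / maxNorm (XK Pr piv Sg (Gam A B Ks)))
          * (cost Pr A B Q R piv Sg K - cost Pr A B Q R piv Sg Ks) := by
  set P := PK Pr A B Q R K with hPdef
  set L := LK Pr A B Q R K with hLdef
  set X0 : Fin N → Matrix (Fin d) (Fin d) ℝ := fun i => piv i • Sg with hX0
  set S : Fin N → Matrix (Fin k) (Fin k) ℝ := fun i => R i + (B i)ᵀ * opE Pr P i * B i with hSdef
  have hRT : ∀ i, (R i)ᵀ = R i := fun i => by
    have := (hR i).1.eq
    rwa [Matrix.conjTranspose_eq_transpose_of_trivial] at this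
  have hstK := stab_of_MSS hK
  have hlyK := PK_isLyap Q R hstK
  have hPpsd : ∀ i, (P i).PosSemidef := by
    refine psd_of_stab hPr hstK fun i => ?_
    have h1 : P i - opL Pr (Gam A B K) P i = Q i + (K i)ᵀ * R i * K i :=
      sub_eq_of_eq_add (hlyK i)
    rw [h1]
    exact (hQ i).posSemidef.add (psd_conj (hR i).posSemidef _)
  have hEpsd : ∀ i, (opE Pr P i).PosSemidef := opE_psd hPr hPpsd
  have hET : ∀ i, (opE Pr P i)ᵀ = opE Pr P i := fun i => by
    have := (hEpsd i).1.eq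
    rwa [Matrix.conjTranspose_eq_transpose_of_trivial] at this
  have hSpsd : ∀ i, (S i).PosSemidef := fun i =>
    (hR i).posSemidef.add (psd_conj (hEpsd i) _)
  have hST : ∀ i, (S i)ᵀ = S i := fun i => by
    have := (hSpsd i).1.eq
    rwa [Matrix.conjTranspose_eq_transpose_of_trivial] at this
  have hdiff := lyap_diff hlyK hRT hET
  -- comparison with another stable policy
  have hcomp : ∀ D : Fin N → Matrix (Fin k) (Fin d) ℝ, Stab Pr (Gam A B (K + D)) →
      (P - PK Pr A B Q R (K + D)) - opL Pr (Gam A B (K + D)) (P - PK Pr A B Q R (K + D))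
        = decr S L D := by
    intro D hD
    have h1 := PK_isLyap Q R hD
    funext i
    have h2 : PK Pr A B Q R (K + D) i - opL Pr (Gam A B (K + D)) (PK Pr A B Q R (K + D)) i
        = Q i + (K i + D i)ᵀ * R i * (K i + D i) := sub_eq_of_eq_add (h1 i)
    have h3 := hdiff D i
    have h4 : ((P - PK Pr A B Q R (K + D))
          - opL Pr (Gam A B (K + D)) (P - PK Pr A B Q R (K + D))) i
        = (P i - opL Pr (Gam A B (K + D)) P i) - (PK Pr A B Q R (K + D) i
          - opL Pr (Gam A B (K + D)) (PK Pr A B Q R (K + D)) i) := by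
      rw [opL_sub]; simp only [Pi.sub_apply]; abel
    rw [h4, h2, h3]
    simp only [decr, hSdef, hLdef, hPdef]
    abel
  set LL : Fin N → Matrix (Fin d) (Fin d) ℝ := fun i => (L i)ᵀ * L i with hLL
  have hLLpsd : ∀ i, (LL i).PosSemidef := fun i => psd_gram _
  -- the natural gradient step
  obtain ⟨D, hDdef⟩ : ∃ D : Fin N → Matrix (Fin k) (Fin d) ℝ, D = -((2 * η) • L) := ⟨_, rfl⟩
  have hKD : K - (2 * η) • L = K + D := by rw [hDdef, sub_eq_add_neg]
  rw [hKD]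
  have hstep : ∀ i, 2 * η * specNorm (S i) ≤ 1 := by
    intro i
    have h1 : specNorm (S i) ≤ ⨆ i, specNorm (S i) :=
      le_ciSup (f := fun i => specNorm (S i)) (Set.finite_range _).bddAbove i
    rcases (specNorm_nonneg (S i)).eq_or_lt with h0 | h0
    · rw [← h0]; simp
    · have h2 : 0 < 2 * ⨆ i, specNorm (S i) := by linarith
      have h3 := (le_div_iff₀ h2).mp hη
      nlinarith
  have hdec : ∀ i, (decr S L D i - ((2 * η) • LL) i).PosSemidef := by
    intro i
    have h1 : ((1 : Matrix (Fin k) (Fin k) ℝ) - (2 * η) • S i).PosSemidef := by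
      have h2 : (1 : Matrix (Fin k) (Fin k) ℝ) - (2 * η) • S i
          = (1 - 2 * η * specNorm (S i)) • 1 + (2 * η) • (specNorm (S i) • 1 - S i) := by
        module
      rw [h2]
      exact (smul_one_psd (by linarith [hstep i])).add
        ((specNorm_psd (hSpsd i).1).smul (by positivity))
    have h3 : decr S L D i - ((2 * η) • LL) i
        = (2 * η) • ((L i)ᵀ * (1 - (2 * η) • S i) * L i) := by
      simp only [decr, hDdef, hLL, Pi.neg_apply, Pi.smul_apply, Matrix.transpose_neg,
        Matrix.transpose_smul, Matrix.neg_mul, Matrix.mul_neg, Matrix.smul_mul, Matrix.mul_smul,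
        Matrix.mul_sub, Matrix.sub_mul, Matrix.mul_one]
      module
    rw [h3]
    exact (psd_conj h1 _).smul (by positivity)
  have hdec0 : ∀ i, (decr S L D i).PosSemidef := by
    intro i
    have := (hdec i).add ((hLLpsd i).smul (show (0:ℝ) ≤ 2 * η by positivity))
    simpa using this
  have hstD : Stab Pr (Gam A B (K + D)) := by
    refine stab_of_ineq hPr hQ hPpsd fun i => ?_
    have h1 : P i - opL Pr (Gam A B (K + D)) P i - Q i
        = (K i + D i)ᵀ * R i * (K i + D i) + decr S L D i := by
      rw [hdiff D i]
      simp only [decr, hSdef, hLdef, hPdef]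
      abel
    rw [h1]
    exact (psd_conj (hR i).posSemidef _).add (hdec0 i)
  have hX0psd : ∀ i, (X0 i).PosSemidef := fun i => hSg.posSemidef.smul (hpiv i).le
  have hmu : 0 ≤ mu piv Sg :=
    mul_nonneg (Real.iInf_nonneg fun i => (hpiv i).le) (sigmaMin_nonneg _)
  set G := tp LL 1 with hG
  have hdescent : 2 * η * (mu piv Sg * G)
      ≤ cost Pr A B Q R piv Sg K - cost Pr A B Q R piv Sg (K + D) := by
    have h1 := hcomp D hstD
    set V := P - PK Pr A B Q R (K + D) with hV
    have h2 : cost Pr A B Q R piv Sg K - cost Pr A B Q R piv Sg (K + D) = tp V X0 := by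
      rw [cost_eq, cost_eq]
      have := tp_add_left V (PK Pr A B Q R (K + D)) X0
      rw [hV, sub_add_cancel] at this
      linarith
    have hVpsd : ∀ i, (V i).PosSemidef := by
      refine psd_of_stab hPr hstD fun i => ?_
      have := congrFun h1 i
      rw [Pi.sub_apply] at this
      rw [this]
      exact hdec0 i
    rw [h2]
    have h3 : tp (decr S L D) X0 ≤ tp V X0 := by
      refine tp_mono_left (fun i => ?_) hX0psd
      rw [← h1, Pi.sub_apply, sub_sub_cancel]
      exact opL_psd hPr _ hVpsd 1 i
    have h4 : tp ((2 * η) • LL) X0 ≤ tp (decr S L D) X0 := tp_mono_left hdec hX0psd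
    have h5 : tp LL (mu piv Sg • 1) ≤ tp LL X0 := by
      refine tp_mono_right hLLpsd fun i => ?_
      have h6 : X0 i - (mu piv Sg • (1 : Fin N → Matrix (Fin d) (Fin d) ℝ)) i
          = piv i • (Sg - sigmaMin Sg • 1) + ((piv i - ⨅ i, piv i) * sigmaMin Sg) • 1 := by
        simp only [hX0, mu, Pi.smul_apply, Pi.one_apply]
        module
      rw [h6]
      refine ((sigmaMin_psd hSg.posSemidef).smul (hpiv i).le).add (smul_one_psd ?_)
      exact mul_nonneg (sub_nonneg.mpr (ciInf_le (Set.finite_range piv).bddBelow i))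
        (sigmaMin_nonneg _)
    rw [tp_smul_right] at h5
    rw [tp_smul_left] at h4
    have h7 := mul_le_mul_of_nonneg_left h5 (show (0:ℝ) ≤ 2 * η by positivity)
    linarith
  -- gradient domination
  set X := XK Pr piv Sg (Gam A B Ks) with hX
  have hXpsd : ∀ i, (X i).PosSemidef := XK_psd hPr hKs hpiv hSg
  have hXeq : X = X0 + opT Pr (Gam A B Ks) X := XK_eq hKs piv Sg
  have hlam0 : 0 ≤ lamMin R := Real.iInf_nonneg fun i => sigmaMin_nonneg _
  have hdom : lamMin R * (cost Pr A B Q R piv Sg K - cost Pr A B Q R piv Sg Ks)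
      ≤ maxNorm X * G := by
    obtain ⟨E, hEdef⟩ : ∃ E : Fin N → Matrix (Fin k) (Fin d) ℝ, Ks = K + E :=
      ⟨Ks - K, by abel⟩
    have hst : Stab Pr (Gam A B (K + E)) := hEdef ▸ stab_of_MSS hKs
    have h1 := hcomp E hst
    rw [← hEdef] at h1
    set V := P - PK Pr A B Q R Ks with hV
    have h2 : cost Pr A B Q R piv Sg K - cost Pr A B Q R piv Sg Ks = tp V X0 := by
      rw [cost_eq, cost_eq]
      have := tp_add_left V (PK Pr A B Q R Ks) X0
      rw [hV, sub_add_cancel] at this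
      linarith
    have h3 : tp V X0 = tp (decr S L E) X := by
      have h4 := tp_add_left (decr S L E) (opL Pr (Gam A B Ks) V) X
      rw [tp_dual, ← h1, sub_add_cancel, h1] at h4
      have h5 := tp_add_right V X0 (opT Pr (Gam A B Ks) X)
      rw [← hXeq] at h5
      linarith
    rw [h2, h3, ← tp_smul_left]
    have h6 : tp (lamMin R • decr S L E) X ≤ tp LL X := by
      refine tp_mono_left (fun i => ?_) hXpsd
      have h7 : LL i - (lamMin R • decr S L E) i
          = (L i + lamMin R • E i)ᵀ * (L i + lamMin R • E i)
            + lamMin R • ((E i)ᵀ * (S i - lamMin R • 1) * E i) := by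
        simp only [decr, hLL, Pi.smul_apply, Matrix.transpose_add,
          Matrix.transpose_smul, Matrix.smul_mul, Matrix.mul_smul, Matrix.add_mul, Matrix.mul_add,
          Matrix.mul_sub, Matrix.sub_mul, Matrix.mul_one]
        module
      rw [h7]
      have h8 : (S i - lamMin R • 1).PosSemidef := by
        have h9 : S i - lamMin R • 1 = (R i - sigmaMin (R i) • 1)
            + (sigmaMin (R i) - lamMin R) • 1 + (B i)ᵀ * opE Pr P i * B i := by
          simp only [hSdef]
          module
        rw [h9]
        refine ((sigmaMin_psd (hR i).posSemidef).add (smul_one_psd ?_)).add (psd_conj (hEpsd i) _)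
        exact sub_nonneg.mpr (ciInf_le (f := fun i => sigmaMin (R i))
          (Set.finite_range _).bddBelow i)
      exact (psd_gram _).add ((psd_conj h8 _).smul hlam0)
    refine h6.trans ?_
    rw [hG, ← tp_smul_right]
    refine tp_mono_right hLLpsd fun i => ?_
    have h10 : (maxNorm X • (1 : Fin N → Matrix (Fin d) (Fin d) ℝ)) i - X i
        = (specNorm (X i) • 1 - X i) + (maxNorm X - specNorm (X i)) • 1 := by
      simp only [Pi.smul_apply, Pi.one_apply]
      module
    rw [h10]
    refine (specNorm_psd (hXpsd i).1).add (smul_one_psd ?_)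
    exact sub_nonneg.mpr (le_ciSup (f := fun i => specNorm (X i))
      (Set.finite_range _).bddAbove i)
  -- conclusion
  have hm0 : 0 ≤ maxNorm X := Real.iSup_nonneg fun i => specNorm_nonneg _
  have hG0 : 0 ≤ G := tp_nonneg hLLpsd fun i => Matrix.PosSemidef.one
  generalize cost Pr A B Q R piv Sg K = c at *
  generalize cost Pr A B Q R piv Sg (K + D) = c1 at *
  generalize cost Pr A B Q R piv Sg Ks = c2 at *
  generalize maxNorm X = m at *
  generalize lamMin R = l at *
  generalize mu piv Sg = u at *
  rcases hm0.eq_or_lt with h0 | h0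
  · rw [← h0, div_zero]
    have : 0 ≤ 2 * η * (u * G) := by positivity
    linarith
  · have h1 : 2 * u * l * η / m * (c - c2) ≤ 2 * η * (u * G) := by
      rw [div_mul_eq_mul_div, div_le_iff₀ h0]
      have := mul_le_mul_of_nonneg_left hdom (show 0 ≤ 2 * η * u by positivity)
      linarith
    linarith

end MJLS
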